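/- In an S2 topology with L ≥ 1 spaces, fix a destination switch t and let s_0, s_1, …, s_k be a walk in the graph (each s_{j+1} a graph neighbor of s_j) such that MCD(χ(s_{j+1}), χ(t)) < MCD(χ(s_j), χ(t)) for every j < k, and such that the walk is maximal, i.e., no graph neighbor v of s_k satisfies MCD(χ(v), χ(t)) < MCD(χ(s_k), χ(t)). Then s_k = t and the switches s_0, …, s_k are pairwise distinct. In particular, any routing protocol (such as S2 multi-path routing) that strictly reduces the MCD to the destination at every hop eventually finds a loop-free path to the destination. -/

import Mathlib

/-- Circular distance on the unit circle `[0,1)` with circumference 1. -/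
noncomputable def CD (x y : ℝ) : ℝ := min |x - y| (1 - |x - y|)

/-- `inArc a b c` : the point `c` lies strictly inside the open circular arc
going from `a` in the positive direction to `b` (coordinates mod 1). -/
def inArc (a b c : ℝ) : Prop :=
  0 < Int.fract (c - a) ∧ Int.fract (c - a) < Int.fract (b - a)

/-- Two points `p ≠ q` of a set `Q` of coordinates are circularly (ring-)adjacent in `Q`
if one of the two open circular arcs between them contains no point of `Q`. -/
def RingAdj (Q : Set ℝ) (p q : ℝ) : Prop :=
  p ∈ Q ∧ q ∈ Q ∧ p ≠ q ∧
    ((∀ r ∈ Q, ¬ inArc p q r) ∨ (∀ r ∈ Q, ¬ inArc q p r))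

/-- Minimum circular distance between two `L`-dimensional coordinate vectors. -/
noncomputable def MCD {L : ℕ} (X Y : Fin L → ℝ) : ℝ := ⨅ i, CD (X i) (Y i)

lemma fract_sub_of_le {a b : ℝ} (h : Int.fract a ≤ Int.fract b) :
    Int.fract (b - a) = Int.fract b - Int.fract a := by
  rw [Int.fract_eq_iff]
  refine ⟨by linarith, by linarith [Int.fract_lt_one b, Int.fract_nonneg a], ⌊b⌋ - ⌊a⌋, ?_⟩
  push_cast
  unfold Int.fract
  ring

lemma fract_sub_Ico {x y : ℝ} (hx : x ∈ Set.Ico (0 : ℝ) 1) (hy : y ∈ Set.Ico (0 : ℝ) 1) :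
    (y ≤ x ∧ Int.fract (x - y) = x - y) ∨ (x < y ∧ Int.fract (x - y) = x - y + 1) := by
  obtain ⟨h1, h2⟩ := hx
  obtain ⟨h3, h4⟩ := hy
  rcases le_or_gt y x with h | h
  · exact Or.inl ⟨h, Int.fract_eq_self.2 ⟨by linarith, by linarith⟩⟩
  · refine Or.inr ⟨h, ?_⟩
    rw [Int.fract_eq_iff]
    exact ⟨by linarith, by linarith, -1, by push_cast; ring⟩

lemma fract_sub_pos {x y : ℝ} (hx : x ∈ Set.Ico (0 : ℝ) 1) (hy : y ∈ Set.Ico (0 : ℝ) 1)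
    (h : x ≠ y) : 0 < Int.fract (x - y) := by
  have h1 := hx.1
  have h2 := hy.2
  rcases fract_sub_Ico hx hy with ⟨h3, h4⟩ | ⟨h3, h4⟩ <;> rw [h4]
  · have := lt_of_le_of_ne h3 h.symm
    linarith
  · linarith

lemma CD_comm' (x y : ℝ) : CD x y = CD y x := by
  unfold CD
  rw [abs_sub_comm]

lemma CD_le_fract {x y : ℝ} (hx : x ∈ Set.Ico (0 : ℝ) 1) (hy : y ∈ Set.Ico (0 : ℝ) 1) :
    CD x y ≤ Int.fract (x - y) := by
  unfold CD
  rcases fract_sub_Ico hx hy with ⟨h3, h4⟩ | ⟨h3, h4⟩ <;> rw [h4]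
  · rw [abs_of_nonneg (by linarith)]
    exact min_le_left _ _
  · rw [abs_of_neg (by linarith)]
    exact (min_le_right _ _).trans (by linarith)

lemma CD_eq_fract {x y : ℝ} (hx : x ∈ Set.Ico (0 : ℝ) 1) (hy : y ∈ Set.Ico (0 : ℝ) 1)
    (hne : x ≠ y) :
    CD x y = Int.fract (x - y) ∨ CD x y = Int.fract (y - x) := by
  unfold CD
  rcases fract_sub_Ico hx hy with ⟨h3, h4⟩ | ⟨h3, h4⟩ <;>
  rcases fract_sub_Ico hy hx with ⟨h5, h6⟩ | ⟨h5, h6⟩ <;> rw [h4, h6]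
  · exact absurd (le_antisymm h5 h3) hne
  · rw [abs_of_nonneg (by linarith)]
    rcases min_choice (x - y) (1 - (x - y)) with h | h <;> rw [h]
    · left; ring
    · right; ring
  · rw [abs_of_neg (by linarith)]
    rcases min_choice (-(x - y)) (1 - -(x - y)) with h | h <;> rw [h]
    · right; ring
    · left; ring
  · linarith

/-- Some ring neighbour is strictly closer to the destination. -/
lemma exists_closer {S : Type*} [Fintype S] (c : S → ℝ)
    (hmem : ∀ s, c s ∈ Set.Ico (0 : ℝ) 1) (hinj : Function.Injective c)
    (u t : S) (hut : u ≠ t) :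
    ∃ v, u ≠ v ∧ RingAdj (Set.range c) (c u) (c v) ∧ CD (c v) (c t) < CD (c u) (c t) := by
  classical
  have hne : (Finset.univ.filter (fun v : S => v ≠ u)).Nonempty := ⟨t, by simp [hut.symm]⟩
  rcases CD_eq_fract (hmem u) (hmem t) (hinj.ne hut) with h | h
  · obtain ⟨v, hv, hmin⟩ := Finset.exists_min_image _ (fun v => Int.fract (c u - c v)) hne
    simp only [Finset.mem_filter, Finset.mem_univ, true_and] at hv hmin
    have hpos := fract_sub_pos (hmem u) (hmem v) (hinj.ne hv.symm)
    refine ⟨v, hv.symm, ⟨⟨u, rfl⟩, ⟨v, rfl⟩, hinj.ne hv.symm, Or.inr ?_⟩, ?_⟩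
    · rintro _ ⟨r, rfl⟩ ⟨h1, h2⟩
      have hr : r ≠ u := by
        rintro rfl
        exact lt_irrefl _ h2
      have h3 := hmin r hr
      have h4 := fract_sub_of_le h2.le
      rw [sub_sub_sub_cancel_right] at h4
      linarith
    · have h4 := fract_sub_of_le (hmin t hut.symm)
      rw [sub_sub_sub_cancel_left] at h4
      have := CD_le_fract (hmem v) (hmem t)
      linarith
  · obtain ⟨v, hv, hmin⟩ := Finset.exists_min_image _ (fun v => Int.fract (c v - c u)) hne
    simp only [Finset.mem_filter, Finset.mem_univ, true_and] at hv hmin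
    have hpos := fract_sub_pos (hmem v) (hmem u) (hinj.ne hv)
    refine ⟨v, hv.symm, ⟨⟨u, rfl⟩, ⟨v, rfl⟩, hinj.ne hv.symm, Or.inl ?_⟩, ?_⟩
    · rintro _ ⟨r, rfl⟩ ⟨h1, h2⟩
      have hr : r ≠ u := by
        rintro rfl
        simp at h1
      have h3 := hmin r hr
      linarith
    · have h4 := fract_sub_of_le (hmin t hut.symm)
      rw [sub_sub_sub_cancel_right] at h4
      have := CD_le_fract (hmem t) (hmem v)
      rw [CD_comm'] at this
      linarith

/-- In an S2 topology with `L ≥ 1` spaces, any maximal walk along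
which the MCD to the destination `t` strictly decreases at every hop ends at `t`,
and its switches are pairwise distinct. -/
theorem stmt_3 {S : Type*} [Fintype S] {L : ℕ} (hL : 1 ≤ L)
    (χ : Fin L → S → ℝ)
    (hmem : ∀ (i : Fin L) (s : S), χ i s ∈ Set.Ico (0 : ℝ) 1)
    (hinj : ∀ i : Fin L, Function.Injective (χ i))
    (G : SimpleGraph S)
    (hG : ∀ (i : Fin L) (u v : S), u ≠ v →
      RingAdj (Set.range (χ i)) (χ i u) (χ i v) → G.Adj u v)
    (t : S) (k : ℕ) (seq : ℕ → S)
    (hwalk : ∀ j < k, G.Adj (seq j) (seq (j + 1)))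
    (hdec : ∀ j < k,
      MCD (fun i => χ i (seq (j + 1))) (fun i => χ i t) <
        MCD (fun i => χ i (seq j)) (fun i => χ i t))
    (hmax : ∀ v : S, G.Adj (seq k) v →
      ¬ MCD (fun i => χ i v) (fun i => χ i t) <
          MCD (fun i => χ i (seq k)) (fun i => χ i t)) :
    seq k = t ∧
      ∀ j₁ j₂ : ℕ, j₁ ≤ k → j₂ ≤ k → seq j₁ = seq j₂ → j₁ = j₂ := by
  constructor
  · by_contra hne
    haveI : Nonempty (Fin L) := ⟨⟨0, hL⟩⟩
    obtain ⟨i, hi⟩ := exists_eq_ciInf_of_finite (f := fun i => CD (χ i (seq k)) (χ i t))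
    obtain ⟨v, hv, hadj, hlt⟩ := exists_closer (χ i) (hmem i) (hinj i) (seq k) t hne
    refine hmax v (hG i _ _ hv hadj) ?_
    have h1 : MCD (fun i => χ i v) (fun i => χ i t) ≤ CD (χ i v) (χ i t) :=
      ciInf_le (f := fun i => CD (χ i v) (χ i t)) (Set.finite_range _).bddBelow i
    have h2 : MCD (fun i => χ i (seq k)) (fun i => χ i t) = CD (χ i (seq k)) (χ i t) := hi.symm
    linarith
  · have key : ∀ a b : ℕ, a < b → b ≤ k →
        MCD (fun i => χ i (seq b)) (fun i => χ i t) <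
          MCD (fun i => χ i (seq a)) (fun i => χ i t) := by
      intro a b hab
      induction b, hab using Nat.le_induction with
      | base => intro h; exact hdec a h
      | succ n hn ih => intro h; exact (hdec n h).trans (ih (by omega))
    intro a b ha hb hab
    rcases lt_trichotomy a b with h | h | h
    · have := key a b h hb
      rw [hab] at this
      exact absurd this (lt_irrefl _)
    · exact h
    · have := key b a h ha
      rw [hab] at this
      exact absurd this (lt_irrefl _)
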